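/- Let (Ω, F, P) be a probability space, T > 0, θ ∈ (0, 1/2), and set θ₁ := 1/2 − θ, θ₂ := 2θ. Let u : [0,T] × [0,1] → Ω → ℝ be a random field such that each u(t,x) is measurable, (t,x) ↦ u(t,x)(ω) is continuous for every ω ∈ Ω, and for every integer p ≥ 1 there is a constant C_p with E[|u(t,x) + u(s,y) − u(t,y) − u(s,x)|^{2p}] ≤ C_p |t − s|^{θ₁ p} |x − y|^{θ₂ p} for all (t,s,x,y) ∈ [0,T]² × [0,1]². Then for all 0 < ξ < θ₁/2 and 0 < η < θ₂/2, almost surely there exists a finite constant C such that |u(t,x)(ω) + u(s,y)(ω) − u(t,y)(ω) − u(s,x)(ω)| ≤ C |t − s|^{ξ} |x − y|^{η} for all (t,s,x,y) ∈ [0,T]² × [0,1]². -/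

import Mathlib

open MeasureTheory Set Real

/-- One-parameter dyadic chaining: a continuous function on `[0, 1]` whose increments over dyadic
cells of length `2⁻ᵐ` are at most `K * 2 ^ (-m * ξ)` is `ξ`-Hölder, with constant linear in `K`. -/
theorem exists_holder_const_of_dyadic_increments {ξ : ℝ} (hξ : 0 < ξ) :
    ∃ c : ℝ, 0 ≤ c ∧ ∀ (g : ℝ → ℝ) (K : ℝ), 0 ≤ K → ContinuousOn g (Icc 0 1) →
      (∀ m i : ℕ, i + 1 ≤ 2 ^ m →
        |g ((i + 1 : ℕ) / 2 ^ m) - g (i / 2 ^ m)| ≤ K * ((1 / 2 : ℝ) ^ ξ) ^ m) →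
      ∀ a ∈ Icc (0 : ℝ) 1, ∀ b ∈ Icc (0 : ℝ) 1, |g a - g b| ≤ c * K * |a - b| ^ ξ := by
  set r : ℝ := (1 / 2 : ℝ) ^ ξ with hr
  have hr0 : 0 < r := by positivity
  have hr1 : r < 1 := Real.rpow_lt_one (by norm_num) (by norm_num) hξ
  have h1r : 0 < 1 - r := sub_pos.2 hr1
  refine ⟨(1 + 2 / (1 - r)) / r, by positivity, fun g K hK hg hinc => ?_⟩
  let d : ℝ → ℕ → ℝ := fun a m => (⌊a * 2 ^ m⌋₊ : ℝ) / 2 ^ m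
  have hfloor_le : ∀ a ∈ Icc (0 : ℝ) 1, ∀ m : ℕ, ⌊a * 2 ^ m⌋₊ ≤ 2 ^ m := by
    intro a ha m
    have h2 : (0 : ℝ) < 2 ^ m := by positivity
    have : ((⌊a * 2 ^ m⌋₊ : ℕ) : ℝ) ≤ ((2 ^ m : ℕ) : ℝ) := by
      refine (Nat.floor_le (mul_nonneg ha.1 h2.le)).trans ?_
      push_cast
      nlinarith [ha.2]
    exact_mod_cast this
  have hd_mem : ∀ a ∈ Icc (0 : ℝ) 1, ∀ m, d a m ∈ Icc (0 : ℝ) 1 := by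
    intro a ha m
    refine ⟨by positivity, (div_le_one (by positivity)).2 ?_⟩
    exact_mod_cast hfloor_le a ha m
  have hd_tendsto : ∀ a ∈ Icc (0 : ℝ) 1, Filter.Tendsto (d a) Filter.atTop (nhds a) := by
    intro a ha
    exact (tendsto_nat_floor_mul_div_atTop ha.1).comp
      (tendsto_pow_atTop_atTop_of_one_lt (by norm_num : (1 : ℝ) < 2))
  have hstep : ∀ a ∈ Icc (0 : ℝ) 1, ∀ m, dist (g (d a m)) (g (d a (m + 1))) ≤ K * r ^ m := by
    intro a ha m
    have h2 : (0 : ℝ) < 2 ^ m := by positivity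
    have hx : 0 ≤ a * 2 ^ m := mul_nonneg ha.1 h2.le
    have hsucc : a * 2 ^ (m + 1) = 2 * (a * 2 ^ m) := by ring
    have hlo : 2 * ⌊a * 2 ^ m⌋₊ ≤ ⌊a * 2 ^ (m + 1)⌋₊ := by
      apply Nat.le_floor
      push_cast
      linarith [Nat.floor_le hx]
    have hhi : ⌊a * 2 ^ (m + 1)⌋₊ < 2 * ⌊a * 2 ^ m⌋₊ + 2 := by
      rw [Nat.floor_lt (by rw [hsucc]; positivity)]
      push_cast
      linarith [Nat.lt_floor_add_one (a * 2 ^ m)]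
    have hcoarse : d a m = ((2 * ⌊a * 2 ^ m⌋₊ : ℕ) : ℝ) / 2 ^ (m + 1) := by
      simp only [d]
      push_cast
      rw [pow_succ]
      field_simp
    rw [dist_comm, Real.dist_eq, hcoarse]
    obtain h | h : ⌊a * 2 ^ (m + 1)⌋₊ = 2 * ⌊a * 2 ^ m⌋₊ ∨
        ⌊a * 2 ^ (m + 1)⌋₊ = 2 * ⌊a * 2 ^ m⌋₊ + 1 := by omega
    · simp only [d, h, sub_self, abs_zero]
      positivity
    · have hle := hfloor_le a ha (m + 1)
      rw [h] at hle
      simp only [d, h]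
      refine (hinc (m + 1) _ hle).trans ?_
      exact mul_le_mul_of_nonneg_left (pow_le_pow_of_le_one hr0.le hr1.le (Nat.le_succ m)) hK
  have hlim : ∀ a ∈ Icc (0 : ℝ) 1, ∀ m, |g (d a m) - g a| ≤ K * r ^ m / (1 - r) := by
    intro a ha m
    rw [← Real.dist_eq]
    refine dist_le_of_le_geometric_of_tendsto r K hr1 (hstep a ha) ?_ m
    exact (hg a ha).tendsto.comp (tendsto_nhdsWithin_iff.2
      ⟨hd_tendsto a ha, Filter.Eventually.of_forall (hd_mem a ha)⟩)
  have key : ∀ a ∈ Icc (0 : ℝ) 1, ∀ b ∈ Icc (0 : ℝ) 1, a < b →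
      |g a - g b| ≤ (1 + 2 / (1 - r)) / r * K * |a - b| ^ ξ := by
    intro a ha b hb hab
    obtain ⟨m, hm1, hm2⟩ := exists_nat_pow_near_of_lt_one (sub_pos.2 hab)
      (by linarith [ha.1, hb.2] : b - a ≤ 1) (by norm_num : (0 : ℝ) < 1 / 2) (by norm_num)
    have h2 : (0 : ℝ) < 2 ^ m := by positivity
    have hba : b * 2 ^ m ≤ a * 2 ^ m + 1 := by
      rw [one_div, inv_pow, ← one_div, le_div_iff₀ h2] at hm2
      linarith
    have hlo : ⌊a * 2 ^ m⌋₊ ≤ ⌊b * 2 ^ m⌋₊ := Nat.floor_mono (by gcongr)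
    have hhi : ⌊b * 2 ^ m⌋₊ ≤ ⌊a * 2 ^ m⌋₊ + 1 := by
      rw [← Nat.floor_add_one (mul_nonneg ha.1 h2.le)]
      exact Nat.floor_mono hba
    have hmid : |g (d b m) - g (d a m)| ≤ K * r ^ m := by
      obtain h | h : ⌊b * 2 ^ m⌋₊ = ⌊a * 2 ^ m⌋₊ ∨ ⌊b * 2 ^ m⌋₊ = ⌊a * 2 ^ m⌋₊ + 1 := by omega
      · simp only [d, h, sub_self, abs_zero]
        positivity
      · have hle := hfloor_le b hb m
        rw [h] at hle
        simp only [d, h]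
        exact hinc m _ hle
    have hpow : r ^ m * r ≤ |a - b| ^ ξ := by
      rw [← pow_succ, hr, ← Real.rpow_natCast, ← Real.rpow_mul (by norm_num), mul_comm ξ,
        Real.rpow_mul (by norm_num), Real.rpow_natCast, abs_sub_comm, abs_of_pos (sub_pos.2 hab)]
      exact Real.rpow_le_rpow (by positivity) hm1.le hξ.le
    have htri : |g a - g b| ≤ K * r ^ m / (1 - r) + K * r ^ m + K * r ^ m / (1 - r) := by
      have e1 := abs_le.1 (hlim a ha m)
      have e2 := abs_le.1 (hlim b hb m)
      have e3 := abs_le.1 hmid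
      rw [abs_le]
      constructor <;> linarith [e1.1, e1.2, e2.1, e2.2, e3.1, e3.2]
    calc |g a - g b| ≤ (1 + 2 / (1 - r)) / r * K * (r ^ m * r) := by
          refine htri.trans_eq ?_
          field_simp
          ring
      _ ≤ _ := by gcongr
  intro a ha b hb
  rcases lt_trichotomy a b with h | rfl | h
  · exact key a ha b hb h
  · simp [Real.zero_rpow hξ.ne']
  · rw [abs_sub_comm (g a), abs_sub_comm a]
    exact key b hb a ha h

/-- Two-parameter dyadic chaining: bounds for the rectangular increments of a continuous function
over dyadic cells give joint Hölder bounds for all its rectangular increments. -/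
theorem exists_rect_holder_of_dyadic_increments {ξ η : ℝ} (hξ : 0 < ξ) (hη : 0 < η)
    (f : ℝ → ℝ → ℝ)
    (hf : ContinuousOn (fun q : ℝ × ℝ => f q.1 q.2) (Icc (0 : ℝ) 1 ×ˢ Icc (0 : ℝ) 1))
    (K : ℝ) (hK : 0 ≤ K)
    (hinc : ∀ m n i j : ℕ, i + 1 ≤ 2 ^ m → j + 1 ≤ 2 ^ n →
      |f ((i + 1 : ℕ) / 2 ^ m) ((j + 1 : ℕ) / 2 ^ n) + f (i / 2 ^ m) (j / 2 ^ n)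
        - f ((i + 1 : ℕ) / 2 ^ m) (j / 2 ^ n) - f (i / 2 ^ m) ((j + 1 : ℕ) / 2 ^ n)|
        ≤ K * ((1 / 2 : ℝ) ^ ξ) ^ m * ((1 / 2 : ℝ) ^ η) ^ n) :
    ∃ C : ℝ, 0 ≤ C ∧ ∀ a ∈ Icc (0 : ℝ) 1, ∀ b ∈ Icc (0 : ℝ) 1,
      ∀ x ∈ Icc (0 : ℝ) 1, ∀ y ∈ Icc (0 : ℝ) 1,
      |f a x + f b y - f a y - f b x| ≤ C * |a - b| ^ ξ * |x - y| ^ η := by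
  obtain ⟨c₁, hc₁, h₁⟩ := exists_holder_const_of_dyadic_increments hξ
  obtain ⟨c₂, hc₂, h₂⟩ := exists_holder_const_of_dyadic_increments hη
  have hleft : ∀ x ∈ Icc (0 : ℝ) 1, ContinuousOn (fun a => f a x) (Icc 0 1) := fun x hx =>
    hf.comp (f := fun a : ℝ => (a, x)) (by fun_prop) fun a ha => ⟨ha, hx⟩
  have hright : ∀ a ∈ Icc (0 : ℝ) 1, ContinuousOn (f a) (Icc 0 1) := fun a ha =>
    hf.comp (f := fun x : ℝ => (a, x)) (by fun_prop) fun x hx => ⟨ha, hx⟩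
  have hdy : ∀ n j : ℕ, j ≤ 2 ^ n → (j / 2 ^ n : ℝ) ∈ Icc (0 : ℝ) 1 := fun n j h =>
    ⟨by positivity, (div_le_one (by positivity)).2 (by exact_mod_cast h)⟩
  refine ⟨c₂ * (c₁ * K), by positivity, fun a ha b hb x hx y hy => ?_⟩
  have h := h₂ (fun z => f a z - f b z) (c₁ * K * |a - b| ^ ξ) (by positivity)
    ((hright a ha).sub (hright b hb)) (fun n j hj => ?_) x hx y hy
  · calc _ = |f a x - f b x - (f a y - f b y)| := by congr 1; ring
      _ ≤ _ := h
      _ = _ := by ring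
  · have h := h₁ (fun z => f z ((j + 1 : ℕ) / 2 ^ n) - f z (j / 2 ^ n))
      (K * ((1 / 2 : ℝ) ^ η) ^ n) (by positivity)
      ((hleft _ (hdy n _ hj)).sub (hleft _ (hdy n _ (by omega)))) (fun m i hi => ?_) a ha b hb
    · calc _ = |f a ((j + 1 : ℕ) / 2 ^ n) - f a (j / 2 ^ n)
              - (f b ((j + 1 : ℕ) / 2 ^ n) - f b (j / 2 ^ n))| := by congr 1; ring
        _ ≤ _ := h
        _ = _ := by ring
    · calc _ = |f ((i + 1 : ℕ) / 2 ^ m) ((j + 1 : ℕ) / 2 ^ n) + f (i / 2 ^ m) (j / 2 ^ n)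
              - f ((i + 1 : ℕ) / 2 ^ m) (j / 2 ^ n) - f (i / 2 ^ m) ((j + 1 : ℕ) / 2 ^ n)| := by
            congr 1; ring
        _ ≤ _ := hinc m n i j hi hj
        _ = _ := by ring

/-- A doubly indexed family of arrays `D m n i j`, `i < 2 ^ m`, `j < 2 ^ n`, of random variables
with `E |D m n i j| ^ k ≤ A * α ^ m * β ^ n` is almost surely bounded by a multiple of
`r ^ m * s ^ n`, uniformly in all indices, once `2 * α < r ^ k` and `2 * β < s ^ k`. -/
theorem ae_exists_bound_of_moment_bound {Ω : Type*} [MeasurableSpace Ω] (P : Measure Ω)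
    (D : ℕ → ℕ → ℕ → ℕ → Ω → ℝ)
    (hD : ∀ m n i j : ℕ, i < 2 ^ m → j < 2 ^ n → Measurable (D m n i j))
    {k : ℕ} (hk : k ≠ 0) {A α β r s : ℝ} (hα : 0 ≤ α) (hβ : 0 ≤ β)
    (hr : 0 < r) (hs : 0 < s) (hαr : 2 * α < r ^ k) (hβs : 2 * β < s ^ k)
    (hmom : ∀ m n i j : ℕ, i < 2 ^ m → j < 2 ^ n →
      ∫⁻ ω, ENNReal.ofReal (|D m n i j ω| ^ k) ∂P ≤ ENNReal.ofReal (A * α ^ m * β ^ n)) :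
    ∀ᵐ ω ∂P, ∃ K : ℝ, 0 ≤ K ∧ ∀ m n i j : ℕ, i < 2 ^ m → j < 2 ^ n →
      |D m n i j ω| ≤ K * r ^ m * s ^ n := by
  let w : ℕ × ℕ → ℝ := fun q => ((r ^ q.1 * s ^ q.2) ^ k)⁻¹
  have hw : ∀ q, 0 < w q := fun q => by positivity
  let S : ℕ × ℕ → Ω → ENNReal := fun q ω =>
    ∑ i ∈ Finset.range (2 ^ q.1), ∑ j ∈ Finset.range (2 ^ q.2),
      ENNReal.ofReal (w q) * ENNReal.ofReal (|D q.1 q.2 i j ω| ^ k)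
  have hterm : ∀ q : ℕ × ℕ, ∀ i ∈ Finset.range (2 ^ q.1), ∀ j ∈ Finset.range (2 ^ q.2),
      Measurable fun ω => ENNReal.ofReal (|D q.1 q.2 i j ω| ^ k) := by
    intro q i hi j hj
    have := hD q.1 q.2 i j (Finset.mem_range.1 hi) (Finset.mem_range.1 hj)
    exact ENNReal.measurable_ofReal.comp ((continuous_abs.measurable.comp this).pow_const k)
  have hrow : ∀ q : ℕ × ℕ, ∀ i ∈ Finset.range (2 ^ q.1), Measurable fun ω =>
      ∑ j ∈ Finset.range (2 ^ q.2),
        ENNReal.ofReal (w q) * ENNReal.ofReal (|D q.1 q.2 i j ω| ^ k) := fun q i hi =>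
    Finset.measurable_fun_sum _ fun j hj => (hterm q i hi j hj).const_mul _
  have hS : ∀ q, Measurable (S q) := fun q => Finset.measurable_fun_sum _ (hrow q)
  have hSint : ∀ q, ∫⁻ ω, S q ω ∂P ≤
      ENNReal.ofReal (A * ((2 * α / r ^ k) ^ q.1 * (2 * β / s ^ k) ^ q.2)) := by
    intro q
    calc ∫⁻ ω, S q ω ∂P
        = ∑ i ∈ Finset.range (2 ^ q.1), ∑ j ∈ Finset.range (2 ^ q.2),
            ENNReal.ofReal (w q) * ∫⁻ ω, ENNReal.ofReal (|D q.1 q.2 i j ω| ^ k) ∂P := by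
          rw [lintegral_finsetSum' _ fun i hi => (hrow q i hi).aemeasurable]
          refine Finset.sum_congr rfl fun i hi => ?_
          rw [lintegral_finsetSum' _ fun j hj => ((hterm q i hi j hj).const_mul _).aemeasurable]
          exact Finset.sum_congr rfl fun j hj => lintegral_const_mul _ (hterm q i hi j hj)
      _ ≤ ∑ i ∈ Finset.range (2 ^ q.1), ∑ j ∈ Finset.range (2 ^ q.2),
            ENNReal.ofReal (w q) * ENNReal.ofReal (A * α ^ q.1 * β ^ q.2) := by
          gcongr with i hi j hj
          exact hmom _ _ _ _ (Finset.mem_range.1 hi) (Finset.mem_range.1 hj)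
      _ = ENNReal.ofReal (2 ^ q.1 * (2 ^ q.2 * (w q * (A * α ^ q.1 * β ^ q.2)))) := by
          rw [ENNReal.ofReal_mul (p := 2 ^ q.1) (by positivity),
            ENNReal.ofReal_mul (p := 2 ^ q.2) (by positivity), ENNReal.ofReal_mul (hw q).le]
          simp [ENNReal.ofReal_pow]
      _ = _ := by
          congr 1
          simp only [w, div_pow, mul_pow, ← pow_mul, mul_comm k]
          field_simp
  have hsum : Summable fun q : ℕ × ℕ =>
      A * ((2 * α / r ^ k) ^ q.1 * (2 * β / s ^ k) ^ q.2) := by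
    refine Summable.mul_left A (Summable.mul_of_nonneg ?_ ?_ ?_ ?_)
    · exact summable_geometric_of_lt_one (by positivity) ((div_lt_one (by positivity)).2 hαr)
    · exact summable_geometric_of_lt_one (by positivity) ((div_lt_one (by positivity)).2 hβs)
    · exact fun m => by positivity
    · exact fun m => by positivity
  have hfin : ∫⁻ ω, ∑' q, S q ω ∂P ≠ ⊤ := by
    rw [lintegral_tsum fun q => (hS q).aemeasurable]
    exact ne_top_of_le_ne_top hsum.tsum_ofReal_ne_top (ENNReal.tsum_le_tsum hSint)
  filter_upwards [ae_lt_top (Measurable.tsum hS) hfin] with ω hω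
  set B : ℝ := (∑' q, S q ω).toReal with hB
  have hB0 : 0 ≤ B := ENNReal.toReal_nonneg
  refine ⟨B + 1, by positivity, fun m n i j hi hj => ?_⟩
  have hle : ENNReal.ofReal (w (m, n) * |D m n i j ω| ^ k) ≤ ∑' q, S q ω := by
    rw [ENNReal.ofReal_mul (hw _).le]
    refine le_trans ?_ (ENNReal.le_tsum (m, n))
    refine le_trans ?_ (Finset.single_le_sum (fun _ _ => zero_le) (Finset.mem_range.2 hi))
    exact Finset.single_le_sum
      (f := fun j => ENNReal.ofReal (w (m, n)) * ENNReal.ofReal (|D m n i j ω| ^ k))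
      (fun _ _ => zero_le) (Finset.mem_range.2 hj)
  have hle' : w (m, n) * |D m n i j ω| ^ k ≤ B := (ENNReal.ofReal_le_iff_le_toReal hω.ne).1 hle
  have hrs : 0 < r ^ m * s ^ n := by positivity
  have hpow : |D m n i j ω| ^ k ≤ ((B + 1) * (r ^ m * s ^ n)) ^ k := by
    calc |D m n i j ω| ^ k ≤ B * (r ^ m * s ^ n) ^ k := by
          simp only [w] at hle'
          rwa [inv_mul_le_iff₀ (by positivity), mul_comm] at hle'
      _ ≤ (B + 1) ^ k * (r ^ m * s ^ n) ^ k := by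
          gcongr
          exact (le_add_of_nonneg_right zero_le_one).trans
            (le_self_pow₀ (le_add_of_nonneg_left hB0) hk)
      _ = _ := (mul_pow _ _ _).symm
  rw [mul_assoc]
  exact le_of_pow_le_pow_left₀ hk (by positivity) hpow

/-- For `2 * ξ < γ` and `p` large, the moment decay `2⁻ᵞᵖ` beats both the number of dyadic cells
and the weight `2 ^ (2 * p * ξ)`. -/
theorem two_mul_half_rpow_lt {ξ γ p : ℝ} (h : 1 < p * (γ - 2 * ξ)) :
    2 * (1 / 2 : ℝ) ^ (γ * p) < (1 / 2 : ℝ) ^ (ξ * (2 * p)) := by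
  have h2 : (2 : ℝ) = (1 / 2 : ℝ) ^ (-1 : ℝ) := by
    rw [Real.rpow_neg_one]
    norm_num
  nth_rewrite 1 [h2]
  rw [← Real.rpow_add (by norm_num)]
  exact Real.rpow_lt_rpow_of_exponent_gt (by norm_num) (by norm_num) (by linarith)

/-- Lemma 3.3 of the paper: almost-sure joint Hölder continuity of the rectangular increments
of a jointly continuous random field whose rectangular increments satisfy the moment bounds
`E[|u(t,x) + u(s,y) - u(t,y) - u(s,x)|^{2p}] ≤ C_p |t-s|^{θ₁ p} |x-y|^{θ₂ p}`. -/
theorem stmt2 {Ω : Type*} [MeasurableSpace Ω] (P : Measure Ω) [IsProbabilityMeasure P]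
    (T : ℝ) (hT : 0 < T) (θ : ℝ) (hθ1 : 0 < θ) (hθ2 : θ < 1/2)
    (u : ℝ → ℝ → Ω → ℝ)
    (hmeas : ∀ t ∈ Icc (0:ℝ) T, ∀ x ∈ Icc (0:ℝ) 1, Measurable (u t x))
    (hcont : ∀ ω, ContinuousOn (fun q : ℝ × ℝ => u q.1 q.2 ω) (Icc 0 T ×ˢ Icc (0:ℝ) 1))
    (hmom : ∀ p : ℕ, 1 ≤ p → ∃ C : ℝ, ∀ t ∈ Icc (0:ℝ) T, ∀ s ∈ Icc (0:ℝ) T,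
      ∀ x ∈ Icc (0:ℝ) 1, ∀ y ∈ Icc (0:ℝ) 1,
      ∫⁻ ω, ENNReal.ofReal (|u t x ω + u s y ω - u t y ω - u s x ω| ^ (2 * p)) ∂P ≤
        ENNReal.ofReal (C * |t - s| ^ ((1/2 - θ) * p) * |x - y| ^ ((2 * θ) * p)))
    (ξ η : ℝ) (hξ1 : 0 < ξ) (hξ2 : ξ < (1/2 - θ) / 2) (hη1 : 0 < η) (hη2 : η < (2 * θ) / 2) :
    ∀ᵐ ω ∂P, ∃ C : ℝ, ∀ t ∈ Icc (0:ℝ) T, ∀ s ∈ Icc (0:ℝ) T,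
      ∀ x ∈ Icc (0:ℝ) 1, ∀ y ∈ Icc (0:ℝ) 1,
      |u t x ω + u s y ω - u t y ω - u s x ω| ≤ C * |t - s| ^ ξ * |x - y| ^ η := by
  obtain ⟨p, hp⟩ := exists_nat_gt
    (max 1 (max (1 / ((1 / 2 - θ) - 2 * ξ)) (1 / (2 * θ - 2 * η))))
  simp only [max_lt_iff] at hp
  obtain ⟨hp1, hpξ, hpη⟩ := hp
  rw [div_lt_iff₀ (by linarith)] at hpξ hpη
  have hp1' : 1 ≤ p := by exact_mod_cast hp1.le
  obtain ⟨C, hC⟩ := hmom p hp1'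
  have hdy : ∀ n j : ℕ, j ≤ 2 ^ n → (j / 2 ^ n : ℝ) ∈ Icc (0 : ℝ) 1 := fun n j h =>
    ⟨by positivity, (div_le_one (by positivity)).2 (by exact_mod_cast h)⟩
  have hscale : ∀ a ∈ Icc (0 : ℝ) 1, T * a ∈ Icc (0 : ℝ) T := fun a ha =>
    ⟨mul_nonneg hT.le ha.1, mul_le_of_le_one_right hT.le ha.2⟩
  have hlen : ∀ n j : ℕ, ((j + 1 : ℕ) / 2 ^ n - j / 2 ^ n : ℝ) = (1 / 2) ^ n := by
    intro n j
    rw [one_div, inv_pow]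
    push_cast
    field_simp
    ring
  have hexp : ∀ (γ : ℝ) (n : ℕ), ((1 / 2 : ℝ) ^ n) ^ γ = ((1 / 2 : ℝ) ^ γ) ^ n := by
    intro γ n
    rw [← Real.rpow_natCast, ← Real.rpow_mul (by norm_num), mul_comm, Real.rpow_mul (by norm_num),
      Real.rpow_natCast]
  have hpow : ∀ γ : ℝ, ((1 / 2 : ℝ) ^ γ) ^ (2 * p) = (1 / 2 : ℝ) ^ (γ * (2 * p)) := by
    intro γ
    rw [← Real.rpow_natCast, ← Real.rpow_mul (by norm_num)]
    push_cast
    rfl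
  have hae := ae_exists_bound_of_moment_bound P
    (fun m n i j ω => u (T * ((i + 1 : ℕ) / 2 ^ m)) ((j + 1 : ℕ) / 2 ^ n) ω
      + u (T * (i / 2 ^ m)) (j / 2 ^ n) ω - u (T * ((i + 1 : ℕ) / 2 ^ m)) (j / 2 ^ n) ω
      - u (T * (i / 2 ^ m)) ((j + 1 : ℕ) / 2 ^ n) ω)
    (fun m n i j hi hj =>
      have ht := hscale _ (hdy m (i + 1) hi)
      have hs := hscale _ (hdy m i hi.le)
      have hx := hdy n (j + 1) hj
      have hy := hdy n j hj.le
      (((hmeas _ ht _ hx).add (hmeas _ hs _ hy)).sub (hmeas _ ht _ hy)).sub (hmeas _ hs _ hx))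
    (k := 2 * p) (by omega) (A := |C| * T ^ ((1 / 2 - θ) * p))
    (α := (1 / 2 : ℝ) ^ ((1 / 2 - θ) * p)) (β := (1 / 2 : ℝ) ^ ((2 * θ) * p))
    (r := (1 / 2 : ℝ) ^ ξ) (s := (1 / 2 : ℝ) ^ η)
    (by positivity) (by positivity) (by positivity) (by positivity)
    (by rw [hpow]; exact two_mul_half_rpow_lt hpξ) (by rw [hpow]; exact two_mul_half_rpow_lt hpη)
    (fun m n i j hi hj => ?_)
  · filter_upwards [hae] with ω ⟨K, hK, hbound⟩
    obtain ⟨C', -, hC'⟩ := exists_rect_holder_of_dyadic_increments hξ1 hη1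
      (fun a x => u (T * a) x ω)
      ((hcont ω).comp (f := fun q : ℝ × ℝ => (T * q.1, q.2)) (by fun_prop)
        fun q hq => ⟨hscale _ hq.1, hq.2⟩)
      K hK hbound
    refine ⟨C' / T ^ ξ, fun t ht s hs x hx y hy => ?_⟩
    have hunscale : ∀ t ∈ Icc (0 : ℝ) T, t / T ∈ Icc (0 : ℝ) 1 := fun t ht =>
      ⟨div_nonneg ht.1 hT.le, (div_le_one hT).2 ht.2⟩
    have h := hC' (t / T) (hunscale t ht) (s / T) (hunscale s hs) x hx y hy
    simp only [mul_div_cancel₀ _ hT.ne'] at h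
    refine h.trans_eq ?_
    rw [← sub_div, abs_div, abs_of_pos hT, Real.div_rpow (abs_nonneg _) hT.le]
    ring
  · refine (hC _ (hscale _ (hdy m (i + 1) hi)) _ (hscale _ (hdy m i hi.le))
      _ (hdy n (j + 1) hj) _ (hdy n j hj.le)).trans (ENNReal.ofReal_le_ofReal ?_)
    rw [← mul_sub, hlen, hlen, abs_mul, abs_of_pos hT, abs_of_pos (by positivity),
      abs_of_pos (by positivity), Real.mul_rpow hT.le (by positivity), hexp, hexp, ← mul_assoc]
    gcongr
    exact le_abs_self C
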